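/- arXiv:1408.0451 — 3 statements merged into one kernel-verified Lean document; each statement's English description precedes it below -/
import Mathlib

section
/- Let w be a finite word with |Alph(w)| ≥ 2, and set m = min{K_w, R_w} and M = max{K_w, R_w}. Then |w| + 2 = R_w + K_w + |Alph(w)| if and only if the factor complexity of w satisfies: C_w(0) = 1, C_w(i) = |Alph(w)| + i - 1 for all 1 ≤ i ≤ m, C_w(i+1) = C_w(i) for all m ≤ i ≤ M - 1, and C_w(i+1) = C_w(i) - 1 for all M ≤ i ≤ |w|. Moreover, when |w| + 2 = R_w + K_w + |Alph(w)| holds, C_w(R_w) = C_w(K_w) and the maximal value of C_w equals m + |Alph(w)| - 1. -/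
open List

variable {A : Type*} [DecidableEq A]

/-- The alphabet of a word: the finite set of distinct letters occurring in it. -/
def Alph (w : List A) : Finset A := w.toFinset

/-- The finset of all factors (contiguous subwords) of `w`. -/
def factors (w : List A) : Finset (List A) :=
  ((Finset.range (w.length + 1)) ×ˢ (Finset.range (w.length + 1))).image
    (fun p => (w.drop p.1).take p.2)

/-- Factor complexity: the number of distinct factors of `w` of length `n`. -/
def C (w : List A) (n : ℕ) : ℕ := ((factors w).filter (fun u => u.length = n)).card

/-- Right-valence of `u` in `w`: the number of distinct letters `x` such that `u ++ [x]`
is a factor of `w`. -/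
def rightValence (w u : List A) : ℕ := ((Alph w).filter (fun x => u ++ [x] <:+: w)).card

/-- `u` is a right special factor of `w`. -/
def RightSpecial (w u : List A) : Prop := u <:+: w ∧ 2 ≤ rightValence w u

/-- `R w`: the smallest positive integer `r` such that `w` has no right special factor
of length `r`. -/
noncomputable def R (w : List A) : ℕ :=
  sInf {r : ℕ | 0 < r ∧ ∀ u : List A, u.length = r → ¬ RightSpecial w u}

/-- The number of occurrences of `u` as a factor of `w`. -/
def occCount (w u : List A) : ℕ :=
  ((Finset.range (w.length + 1)).filter
    (fun i => i + u.length ≤ w.length ∧ (w.drop i).take u.length = u)).card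

/-- `K w`: the length of the shortest suffix of `w` occurring exactly once in `w`. -/
noncomputable def K (w : List A) : ℕ :=
  sInf {k : ℕ | ∃ u : List A, u <:+ w ∧ u.length = k ∧ occCount w u = 1}

/-- Left-valence of `u` in `w`. -/
def leftValence (w u : List A) : ℕ := ((Alph w).filter (fun x => x :: u <:+: w)).card

/-- `u` is a left special factor of `w`. -/
def LeftSpecial (w u : List A) : Prop := u <:+: w ∧ 2 ≤ leftValence w u

/-- `L w`: the smallest positive integer `ℓ` such that `w` has no left special factor
of length `ℓ`. -/
noncomputable def L (w : List A) : ℕ :=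
  sInf {r : ℕ | 0 < r ∧ ∀ u : List A, u.length = r → ¬ LeftSpecial w u}

/-- `H w`: the length of the shortest prefix of `w` occurring exactly once in `w`. -/
noncomputable def H (w : List A) : ℕ :=
  sInf {k : ℕ | ∃ u : List A, u <+: w ∧ u.length = k ∧ occCount w u = 1}

/-- A generalized trapezoidal word. -/
def IsGT (w : List A) : Prop :=
  w ≠ [] ∧ ((Alph w).card = 1 ∨
    ∃ m M : ℕ, 0 < m ∧ m ≤ M ∧
      (∀ i, 1 ≤ i → i ≤ m → C w i = (Alph w).card + i - 1) ∧
      (∀ i, m ≤ i → i ≤ M - 1 → C w (i + 1) = C w i) ∧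
      (∀ i, M ≤ i → i ≤ w.length → C w (i + 1) = C w i - 1))

/-- The heart of a word: remove the longest prefix and longest suffix consisting of
letters that occur exactly once in the word (if some letter repeats); otherwise the
word itself. -/
def heart (w : List A) : List A :=
  if ∀ x ∈ w, w.count x = 1 then w
  else
    ((w.dropWhile (fun x => w.count x == 1)).reverse.dropWhile
      (fun x => w.count x == 1)).reverse

/-- A word is rich if it has exactly `|w| + 1` distinct palindromic factors. -/
def Rich (w : List A) : Prop :=
  ((factors w).filter (fun u => u.reverse = u)).card = w.length + 1

/-- `p` is a period of `w`. -/
def IsPeriod (w : List A) (p : ℕ) : Prop :=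
  0 < p ∧ ∀ i : ℕ, i + p < w.length → w[i]? = w[i + p]?

/-- The minimal period of `w`. -/
noncomputable def minPeriod (w : List A) : ℕ := sInf {p : ℕ | IsPeriod w p}


theorem mem_factors_iff (w u : List A) : u ∈ factors w ↔ u <:+: w := by
  unfold factors
  simp only [Finset.mem_image, Finset.mem_product, Finset.mem_range, Prod.exists]
  constructor
  · rintro ⟨i, j, -, rfl⟩
    exact (List.take_prefix _ _).isInfix.trans (List.drop_suffix _ _).isInfix
  · rintro ⟨s, t, rfl⟩
    refine ⟨s.length, u.length, ?_, ?_⟩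
    · simp; omega
    · simp

/-- Factors of length `n`. -/
def Fac (w : List A) (n : ℕ) : Finset (List A) := (factors w).filter (fun u => u.length = n)

theorem mem_Fac (w u : List A) (n : ℕ) : u ∈ Fac w n ↔ u <:+: w ∧ u.length = n := by
  simp [Fac, mem_factors_iff]

theorem C_eq (w : List A) (n : ℕ) : C w n = (Fac w n).card := rfl

theorem mem_alph_of_infix {w u : List A} {x : A} (h : u ++ [x] <:+: w) : x ∈ Alph w := by
  unfold Alph
  rw [List.mem_toFinset]
  exact h.subset (by simp)

theorem rv_eq_zero (w u : List A) : rightValence w u = 0 ↔ ∀ x, ¬ (u ++ [x] <:+: w) := by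
  unfold rightValence
  rw [Finset.card_eq_zero, Finset.filter_eq_empty_iff]
  exact ⟨fun h x hx => h (mem_alph_of_infix hx) hx, fun h x _ => h x⟩

theorem rv_mono {w u v : List A} (h : u <:+ v) : rightValence w v ≤ rightValence w u := by
  unfold rightValence
  apply Finset.card_le_card
  intro x
  simp only [Finset.mem_filter]
  rintro ⟨h1, h2⟩
  refine ⟨h1, List.IsInfix.trans ?_ h2⟩
  obtain ⟨t, rfl⟩ := h
  exact ⟨t, [], by simp⟩

theorem C_succ (w : List A) (n : ℕ) : C w (n + 1) = ∑ u ∈ Fac w n, rightValence w u := by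
  have : Fac w (n + 1) = (Fac w n).biUnion
      (fun u => ((Alph w).filter (fun x => u ++ [x] <:+: w)).image (fun x => u ++ [x])) := by
    ext v
    simp only [Finset.mem_biUnion, Finset.mem_image, Finset.mem_filter, mem_Fac]
    constructor
    · rintro ⟨h1, h2⟩
      have hne : v ≠ [] := by rintro rfl; simp at h2
      have e := List.dropLast_append_getLast hne
      have h3 : v.dropLast ++ [v.getLast hne] <:+: w := by rw [e]; exact h1
      refine ⟨v.dropLast, ⟨(List.dropLast_prefix v).isInfix.trans h1, by simp [h2]⟩,
        v.getLast hne, ⟨mem_alph_of_infix h3, h3⟩, e⟩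
    · rintro ⟨u, ⟨h1, h2⟩, x, ⟨h3, h4⟩, rfl⟩
      exact ⟨h4, by simp [h2]⟩
  rw [C_eq, this, Finset.card_biUnion]
  · apply Finset.sum_congr rfl
    intro u _
    rw [Finset.card_image_of_injective]
    · rfl
    · intro x y h; simpa using h
  · intro u _ v _ huv
    rw [Function.onFun, Finset.disjoint_left]
    intro z hz hz'
    simp only [Finset.mem_image] at hz hz'
    obtain ⟨x, -, rfl⟩ := hz
    obtain ⟨y, -, h⟩ := hz'
    exact huv (List.append_inj_left' h rfl).symm

theorem occ_iff {w u : List A} (hu : u <:+ w) : occCount w u = 1 ↔ rightValence w u = 0 := by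
  rw [rv_eq_zero]
  have hl := hu.length_le
  have he := List.suffix_iff_eq_drop.1 hu
  have hmem : w.length - u.length ∈ (Finset.range (w.length + 1)).filter
    (fun i => i + u.length ≤ w.length ∧ (w.drop i).take u.length = u) := by
    simp only [Finset.mem_filter, Finset.mem_range]
    refine ⟨by omega, by omega, ?_⟩
    rw [← he]; simp
  unfold occCount
  rw [Finset.card_eq_one]
  constructor
  · rintro ⟨a, ha⟩ x ⟨s, t, hst⟩
    have h2 : s.length ∈ (Finset.range (w.length + 1)).filter
      (fun i => i + u.length ≤ w.length ∧ (w.drop i).take u.length = u) := by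
      simp only [Finset.mem_filter, Finset.mem_range]
      rw [← hst]
      refine ⟨by simp, by simp, by simp⟩
    rw [ha, Finset.mem_singleton] at hmem h2
    have := congrArg List.length hst
    simp at this
    omega
  · intro h
    refine ⟨w.length - u.length, ?_⟩
    apply Finset.eq_singleton_iff_unique_mem.2 ⟨hmem, ?_⟩
    intro i hi
    simp only [Finset.mem_filter, Finset.mem_range] at hi
    obtain ⟨_, h1, h2⟩ := hi
    by_contra hne
    have hlt : i + u.length < w.length := by omega
    apply h (w[i + u.length])
    refine ⟨w.take i, w.drop (i + u.length + 1), ?_⟩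
    have h3 : w.drop i = u ++ w.drop (i + u.length) := by
      conv_lhs => rw [← List.take_append_drop u.length (w.drop i), h2, List.drop_drop]
    conv_rhs => rw [← List.take_append_drop i w, h3, List.drop_eq_getElem_cons hlt]
    simp

/-- Suffix of length `n`. -/
def Suf (w : List A) (n : ℕ) : List A := w.drop (w.length - n)

theorem Suf_suffix (w : List A) (n : ℕ) : Suf w n <:+ w := List.drop_suffix _ _

theorem Suf_length (w : List A) {n : ℕ} (h : n ≤ w.length) : (Suf w n).length = n := by
  simp [Suf]; omega

theorem suffix_eq_Suf {w u : List A} (h : u <:+ w) : u = Suf w u.length :=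
  List.suffix_iff_eq_drop.1 h

theorem rv_self (w u : List A) (h : w.length ≤ u.length) : rightValence w u = 0 := by
  rw [rv_eq_zero]
  intro x hx
  have := hx.length_le
  simp at this
  omega

theorem K_spec (w : List A) :
    K w ≤ w.length ∧ rightValence w (Suf w (K w)) = 0 := by
  have hw : w.length ∈ {k : ℕ | ∃ u : List A, u <:+ w ∧ u.length = k ∧ occCount w u = 1} :=
    ⟨w, List.suffix_refl w, rfl, (occ_iff (List.suffix_refl w)).2 (rv_self w w le_rfl)⟩
  refine ⟨Nat.sInf_le hw, ?_⟩
  obtain ⟨u, h1, h2, h3⟩ := Nat.sInf_mem ⟨_, hw⟩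
  change u.length = K w at h2
  rw [← h2, ← suffix_eq_Suf h1]
  exact (occ_iff h1).1 h3

theorem K_le_iff (w : List A) {n : ℕ} (hn : n ≤ w.length) :
    K w ≤ n ↔ rightValence w (Suf w n) = 0 := by
  obtain ⟨h1, h2⟩ := K_spec w
  constructor
  · intro h
    have : Suf w (K w) <:+ Suf w n := by
      apply List.suffix_of_suffix_length_le (Suf_suffix _ _) (Suf_suffix _ _)
      rw [Suf_length w h1, Suf_length w hn]; exact h
    have := rv_mono (w := w) this
    omega
  · intro h
    exact Nat.sInf_le ⟨Suf w n, Suf_suffix _ _, Suf_length w hn, (occ_iff (Suf_suffix _ _)).2 h⟩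

theorem card_rv_zero (w : List A) {n : ℕ} (hn : n ≤ w.length) :
    ((Fac w n).filter (fun u => rightValence w u = 0)).card = if K w ≤ n then 1 else 0 := by
  have key : ∀ u ∈ Fac w n, rightValence w u = 0 → u = Suf w n := by
    intro u hu h
    rw [mem_Fac] at hu
    obtain ⟨⟨s, t, hst⟩, hl⟩ := hu
    rw [rv_eq_zero] at h
    cases t with
    | nil =>
      rw [← hl]
      exact suffix_eq_Suf ⟨s, by simpa using hst⟩
    | cons x t => exact absurd ⟨s, t, by simpa using hst⟩ (h x)
  split_ifs with hK
  · rw [Finset.card_eq_one]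
    refine ⟨Suf w n, Finset.eq_singleton_iff_unique_mem.2 ⟨?_, ?_⟩⟩
    · rw [Finset.mem_filter, mem_Fac]
      exact ⟨⟨(Suf_suffix _ _).isInfix, Suf_length w hn⟩, (K_le_iff w hn).1 hK⟩
    · intro u hu
      rw [Finset.mem_filter] at hu
      exact key u hu.1 hu.2
  · rw [Finset.card_eq_zero, Finset.filter_eq_empty_iff]
    intro u hu h
    apply hK
    rw [K_le_iff w hn, ← key u hu h]
    exact h

/-- Total excess right-valence at length `n`. -/
def Sx (w : List A) (n : ℕ) : ℕ := ∑ u ∈ Fac w n, (rightValence w u - 1)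

theorem C_step (w : List A) {n : ℕ} (hn : n ≤ w.length) :
    C w (n + 1) + (if K w ≤ n then 1 else 0) = C w n + Sx w n := by
  rw [← card_rv_zero w hn, C_succ, C_eq, Sx, Finset.card_filter, Finset.card_eq_sum_ones,
    ← Finset.sum_add_distrib, ← Finset.sum_add_distrib]
  apply Finset.sum_congr rfl
  intro u _
  split_ifs <;> omega

theorem Sx_eq_zero (w : List A) (n : ℕ) :
    Sx w n = 0 ↔ ∀ u : List A, u.length = n → ¬ RightSpecial w u := by
  rw [Sx, Finset.sum_eq_zero_iff]
  constructor
  · rintro h u hu ⟨h1, h2⟩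
    have := h u ((mem_Fac _ _ _).2 ⟨h1, hu⟩)
    omega
  · intro h u hu
    rw [mem_Fac] at hu
    by_contra hc
    exact h u hu.2 ⟨hu.1, by omega⟩

theorem R_spec (w : List A) (hw : 0 < w.length) :
    0 < R w ∧ R w ≤ w.length ∧ Sx w (R w) = 0 := by
  have h : w.length ∈ {r : ℕ | 0 < r ∧ ∀ u : List A, u.length = r → ¬ RightSpecial w u} := by
    refine ⟨hw, ?_⟩
    rintro u hu ⟨_, h2⟩
    have := rv_self w u hu.ge
    omega
  have := Nat.sInf_mem ⟨_, h⟩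
  exact ⟨this.1, Nat.sInf_le h, (Sx_eq_zero _ _).2 this.2⟩

theorem Sx_pos (w : List A) {n : ℕ} (h0 : 0 < n) (hn : n < R w) : 1 ≤ Sx w n := by
  by_contra hc
  have : R w ≤ n := Nat.sInf_le ⟨h0, (Sx_eq_zero w n).1 (by omega)⟩
  omega

theorem Sx_zero_of_ge (w : List A) (hw : 0 < w.length) {n : ℕ} (hn : R w ≤ n) : Sx w n = 0 := by
  have h := (Sx_eq_zero _ _).1 (R_spec w hw).2.2
  rw [Sx_eq_zero]
  rintro u hu ⟨h1, h2⟩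
  have hs : u.drop (u.length - R w) <:+ u := List.drop_suffix _ _
  refine h (u.drop (u.length - R w)) (by simp; omega) ⟨hs.isInfix.trans h1, ?_⟩
  exact h2.trans (rv_mono hs)

theorem C_zero (w : List A) : C w 0 = 1 := by
  rw [C_eq, Finset.card_eq_one]
  refine ⟨[], ?_⟩
  ext u
  simp only [mem_Fac, Finset.mem_singleton, List.length_eq_zero_iff]
  constructor
  · exact fun h => h.2
  · rintro rfl; exact ⟨List.nil_infix, rfl⟩

theorem C_one (w : List A) : C w 1 = (Alph w).card := by
  have : Fac w 0 = {[]} := by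
    ext u
    simp only [mem_Fac, Finset.mem_singleton, List.length_eq_zero_iff]
    constructor
    · exact fun h => h.2
    · rintro rfl; exact ⟨List.nil_infix, rfl⟩
  rw [C_succ, this, Finset.sum_singleton, rightValence, Finset.filter_true_of_mem]
  intro x hx
  unfold Alph at hx
  rw [List.mem_toFinset] at hx
  obtain ⟨s, t, rfl⟩ := List.append_of_mem hx
  exact ⟨s, t, by simp⟩

theorem C_big (w : List A) {n : ℕ} (h : w.length < n) : C w n = 0 := by
  rw [C_eq, Finset.card_eq_zero]
  apply Finset.eq_empty_of_forall_notMem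
  intro u hu
  rw [mem_Fac] at hu
  have := hu.1.length_le
  omega

theorem C_pos (w : List A) {n : ℕ} (h : n ≤ w.length) : 0 < C w n := by
  rw [C_eq, Finset.card_pos]
  exact ⟨Suf w n, (mem_Fac _ _ _).2 ⟨(Suf_suffix _ _).isInfix, Suf_length w h⟩⟩

theorem K_pos (w : List A) (hw : 0 < w.length) : 0 < K w := by
  by_contra hc
  have h1 := (K_le_iff w (Nat.zero_le w.length)).1 (by omega)
  have e : Suf w 0 = [] := by simp [Suf]
  rw [e, rv_eq_zero] at h1
  obtain ⟨x, t, rfl⟩ := List.exists_cons_of_length_pos hw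
  exact h1 x ⟨[], t, by simp⟩

/-- The arithmetic core: a telescoping identity. -/
theorem telescoped (w : List A) (hw : 0 < w.length) (n : ℕ) (hn : n ≤ w.length) :
    C w (n + 1) + (n + 1 - K w) = (Alph w).card + ∑ i ∈ Finset.range n, Sx w (i + 1) := by
  induction n with
  | zero =>
    have := K_pos w hw
    simp [C_one]; omega
  | succ k ih =>
    have h1 := ih (by omega)
    have h2 := C_step w hn
    rw [Finset.sum_range_succ]
    split_ifs at h2 <;> omega

theorem sum_Sx (w : List A) (hw : 0 < w.length) :
    w.length + 1 = K w + (Alph w).card + ∑ i ∈ Finset.range (R w - 1), Sx w (i + 1) := by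
  have h := telescoped w hw w.length le_rfl
  rw [C_big w (Nat.lt_succ_self _)] at h
  have hR := R_spec w hw
  have : ∑ i ∈ Finset.range (R w - 1), Sx w (i + 1)
      = ∑ i ∈ Finset.range w.length, Sx w (i + 1) := by
    apply Finset.sum_subset
    · intro i; simp only [Finset.mem_range]; omega
    · intro i _ hi
      simp only [Finset.mem_range] at hi
      exact Sx_zero_of_ge w hw (by omega)
  have := (K_spec w).1
  omega

theorem Sx_one (w : List A) (hw : 0 < w.length)
    (h : w.length + 2 = R w + K w + (Alph w).card) (n : ℕ) (h0 : 0 < n) (hn : n < R w) :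
    Sx w n = 1 := by
  have h1 := sum_Sx w hw
  have h2 : ∑ i ∈ Finset.range (R w - 1), 1 = ∑ i ∈ Finset.range (R w - 1), Sx w (i + 1) := by
    simp; omega
  have h3 := (Finset.sum_eq_sum_iff_of_le (fun i hi => by
    rw [Finset.mem_range] at hi
    exact Sx_pos w (Nat.succ_pos i) (by omega))).1 h2 (n - 1) (by rw [Finset.mem_range]; omega)
  rw [h3]; congr 1; omega

theorem stmt0 (w : List A) (h2 : 2 ≤ (Alph w).card)
    (m M : ℕ) (hm : m = min (K w) (R w)) (hM : M = max (K w) (R w)) :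
    (w.length + 2 = R w + K w + (Alph w).card ↔
      (C w 0 = 1 ∧
       (∀ i, 1 ≤ i → i ≤ m → C w i = (Alph w).card + i - 1) ∧
       (∀ i, m ≤ i → i ≤ M - 1 → C w (i + 1) = C w i) ∧
       (∀ i, M ≤ i → i ≤ w.length → C w (i + 1) = C w i - 1))) ∧
    (w.length + 2 = R w + K w + (Alph w).card →
      C w (R w) = C w (K w) ∧
      (∀ n, C w n ≤ m + (Alph w).card - 1) ∧
      (∃ n, C w n = m + (Alph w).card - 1)) := by
  have hw : 0 < w.length := by
    by_contra hc
    have : w = [] := List.length_eq_zero_iff.1 (by omega)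
    subst this
    simp [Alph] at h2
  obtain ⟨hR0, hRL, -⟩ := R_spec w hw
  have hKL := (K_spec w).1
  have hK0 := K_pos w hw
  have hm0 : 1 ≤ m := by omega
  have hmM : m ≤ M := by omega
  have hML : M ≤ w.length := by omega
  -- values on the plateau
  have plateau : (∀ i, m ≤ i → i ≤ M - 1 → C w (i + 1) = C w i) →
      ∀ i, m ≤ i → i ≤ M → C w i = C w m := by
    intro h i hi
    induction i, hi using Nat.le_induction with
    | base => intro _; rfl
    | succ k hk ih => intro hkM; rw [h k hk (by omega)]; exact ih (by omega)
  have decr : (∀ i, M ≤ i → i ≤ w.length → C w (i + 1) = C w i - 1) →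
      ∀ i, M ≤ i → i ≤ w.length + 1 → C w i + i = C w M + M := by
    intro h i hi
    induction i, hi using Nat.le_induction with
    | base => intro _; rfl
    | succ k hk ih =>
      intro hkM
      have := C_pos w (n := k) (by omega)
      have := h k hk (by omega)
      have := ih (by omega)
      omega
  have fwd : w.length + 2 = R w + K w + (Alph w).card →
      (C w 0 = 1 ∧
       (∀ i, 1 ≤ i → i ≤ m → C w i = (Alph w).card + i - 1) ∧
       (∀ i, m ≤ i → i ≤ M - 1 → C w (i + 1) = C w i) ∧
       (∀ i, M ≤ i → i ≤ w.length → C w (i + 1) = C w i - 1)) := by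
    intro h
    have hS := Sx_one w hw h
    refine ⟨C_zero w, ?_, ?_, ?_⟩
    · intro i hi
      induction i, hi using Nat.le_induction with
      | base => intro _; rw [C_one]; omega
      | succ k hk ih =>
        intro hkm
        have h1 := ih (by omega)
        have h3 := C_step w (n := k) (by omega)
        rw [hS k (by omega) (by omega), if_neg (by omega)] at h3
        omega
    · intro i h1 h3
      have h4 := C_step w (n := i) (by omega)
      rcases le_total (K w) (R w) with hc | hc
      · rw [hS i (by omega) (by omega), if_pos (by omega)] at h4
        omega
      · rw [Sx_zero_of_ge w hw (by omega), if_neg (by omega)] at h4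
        omega
    · intro i h1 h3
      have h4 := C_step w h3
      rw [Sx_zero_of_ge w hw (by omega), if_pos (by omega)] at h4
      omega
  refine ⟨⟨fwd, ?_⟩, ?_⟩
  · rintro ⟨-, ha, hb, hc⟩
    have e1 := ha m hm0 le_rfl
    have e2 := plateau hb M hmM le_rfl
    have e3 := decr hc (w.length + 1) (by omega) le_rfl
    rw [C_big w (Nat.lt_succ_self _)] at e3
    omega
  · intro h
    obtain ⟨-, ha, hb, hc⟩ := fwd h
    have e1 := ha m hm0 le_rfl
    have e2 := plateau hb M hmM le_rfl
    refine ⟨?_, ?_, m, by omega⟩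
    · rw [plateau hb (R w) (by omega) (by omega), plateau hb (K w) (by omega) (by omega)]
    · intro n
      rcases Nat.eq_zero_or_pos n with rfl | hn
      · rw [C_zero]; omega
      rcases le_total n m with h1 | h1
      · rw [ha n hn h1]; omega
      rcases le_total n M with h3 | h3
      · rw [plateau hb n h1 h3]; omega
      rcases le_or_gt n w.length with h4 | h4
      · have := decr hc n h3 (by omega); omega
      · rw [C_big w h4]; omega
end

section
/- Every nonempty finite word w satisfies |w| + 2 ≥ R_w + K_w + |Alph(w)| and |w| + 2 ≥ L_w + H_w + |Alph(w)|. -/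
open List

variable {A : Type*} [DecidableEq A]

/-- Factors of length n. -/
def facLen (w : List A) (n : ℕ) : Finset (List A) := (factors w).filter (fun u => u.length = n)

theorem mem_facLen (w u : List A) (n : ℕ) : u ∈ facLen w n ↔ u <:+: w ∧ u.length = n := by
  simp [facLen, mem_factors_iff]

theorem step_core (w : List A) (r k n : ℕ)
    (hr : n < r → ∃ u x y, x ≠ y ∧ u.length = n ∧ u ++ [x] <:+: w ∧ u ++ [y] <:+: w)
    (hk : n < k → ∀ s, s <:+ w → s.length = n → ∃ x, s ++ [x] <:+: w) (hn : n ≤ w.length) :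
    (facLen w n).card + (if n < r then 1 else 0)
      ≤ (facLen w (n+1)).card + (if k ≤ n then 1 else 0) := by
  have ext : ∀ u ∈ facLen w n, ¬ (k ≤ n ∧ u = w.drop (w.length - n)) → ∃ x, u ++ [x] <:+: w := by
    intro u hu hne
    rw [mem_facLen] at hu
    obtain ⟨⟨a, b, hab⟩, hl⟩ := hu
    cases b with
    | nil =>
      have hs : u <:+ w := ⟨a, by simpa using hab⟩
      have : u = w.drop (w.length - n) := by
        have := List.suffix_iff_eq_drop.mp hs
        rwa [hl] at this
      exact hk (by by_contra h; exact hne ⟨by omega, this⟩) u hs hl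
    | cons x b => exact ⟨x, a, b, by simpa using hab⟩
  have hB : (facLen w n).card ≤ ((facLen w n).filter
      (fun u => ¬ (k ≤ n ∧ u = w.drop (w.length - n)))).card + (if k ≤ n then 1 else 0) := by
    split_ifs with h
    · have : (facLen w n).filter (fun u => ¬ (k ≤ n ∧ u = w.drop (w.length - n)))
          = (facLen w n).erase (w.drop (w.length - n)) := by
        ext u; simp [h, and_comm]
      rw [this]
      have := Finset.pred_card_le_card_erase (s := facLen w n) (a := w.drop (w.length - n))
      omega
    · simp [h]
  have hG : ((facLen w n).filter
      (fun u => ¬ (k ≤ n ∧ u = w.drop (w.length - n)))).card + (if n < r then 1 else 0)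
      ≤ (facLen w (n+1)).card := by
    split_ifs with h
    · obtain ⟨u, x, y, hxy, hl, hx, hy⟩ := hr h
      have hm : u ++ [x] ∈ facLen w (n+1) := by rw [mem_facLen]; exact ⟨hx, by simp [hl]⟩
      rw [← Finset.card_erase_add_one hm]
      refine Nat.add_le_add_right (le_trans (Finset.card_le_card (t :=
        ((facLen w (n+1)).erase (u ++ [x])).image List.dropLast) ?_) Finset.card_image_le) 1
      intro v hv
      rw [Finset.mem_filter] at hv
      have hvl := ((mem_facLen _ _ _).1 hv.1).2
      rw [Finset.mem_image]
      by_cases huv : v = u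
      · subst huv
        refine ⟨v ++ [y], ?_, by simp⟩
        rw [Finset.mem_erase, mem_facLen]
        exact ⟨by simpa using hxy.symm, hy, by simp [hl]⟩
      · obtain ⟨z, hz⟩ := ext v hv.1 hv.2
        refine ⟨v ++ [z], ?_, by simp⟩
        rw [Finset.mem_erase, mem_facLen]
        refine ⟨fun h => huv ?_, hz, by simp [hvl]⟩
        exact (List.append_inj h (by omega)).1
    · refine (le_trans (Finset.card_le_card (t :=
        (facLen w (n+1)).image List.dropLast) ?_) Finset.card_image_le)
      intro v hv
      rw [Finset.mem_filter] at hv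
      have hvl := ((mem_facLen _ _ _).1 hv.1).2
      rw [Finset.mem_image]
      obtain ⟨z, hz⟩ := ext v hv.1 hv.2
      refine ⟨v ++ [z], ?_, by simp⟩
      rw [mem_facLen]
      exact ⟨hz, by simp [hvl]⟩
  omega

theorem core (w : List A) (r k : ℕ)
    (hw : w ≠ [])
    (hr : ∀ n, 0 < n → n < r →
      ∃ u x y, x ≠ y ∧ u.length = n ∧ u ++ [x] <:+: w ∧ u ++ [y] <:+: w)
    (hk : ∀ n, n < k → ∀ s, s <:+ w → s.length = n → ∃ x, s ++ [x] <:+: w) :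
    r + k + (Alph w).card ≤ w.length + 2 := by
  have hpos : 0 < w.length := List.length_pos_iff.mpr hw
  have hr1 : r ≤ w.length := by
    by_contra h
    obtain ⟨u, x, y, -, hl, hx, -⟩ := hr w.length hpos (by omega)
    have := hx.length_le
    simp [hl] at this
  have hk1 : k ≤ w.length := by
    by_contra h
    obtain ⟨x, hx⟩ := hk w.length (by omega) w (List.suffix_refl _) rfl
    have := hx.length_le
    simp at this
  have h1 : (Alph w).card ≤ (facLen w 1).card := by
    apply Finset.card_le_card_of_injOn (fun x => [x])
    · intro x hx
      have hx : x ∈ w := by simpa [Alph] using hx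
      simp only [Finset.mem_coe, mem_facLen]
      obtain ⟨s, t, rfl⟩ := List.append_of_mem hx
      exact ⟨⟨s, t, by simp⟩, rfl⟩
    · intro x _ y _ h
      simpa using h
  have main : ∀ n, n ≤ w.length →
      (Alph w).card + min (n+1) r ≤ (facLen w (n+1)).card + (n + 1 - k) + 1 := by
    intro n
    induction n with
    | zero => intro _; simp only [zero_add]; omega
    | succ n ih =>
      intro hn
      have h := ih (by omega)
      have s := step_core w r k (n+1) (hr _ (by omega)) (hk _) hn
      split_ifs at s <;> omega
  have hz : (facLen w (w.length + 1)).card = 0 := by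
    rw [Finset.card_eq_zero, Finset.eq_empty_iff_forall_notMem]
    intro u hu
    rw [mem_facLen] at hu
    have := hu.1.length_le
    omega
  have := main w.length le_rfl
  omega

/-- If a factor occurring at position p does not occur exactly once, there is another one. -/
theorem exists_other (w u : List A) (p : ℕ) (hp : p + u.length ≤ w.length)
    (hpu : (w.drop p).take u.length = u) (h : occCount w u ≠ 1) :
    ∃ i, i ≠ p ∧ i + u.length ≤ w.length ∧ (w.drop i).take u.length = u := by
  by_contra hc
  push Not at hc
  apply h
  unfold occCount
  rw [Finset.card_eq_one]
  refine ⟨p, ?_⟩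
  ext i
  simp only [Finset.mem_filter, Finset.mem_range, Finset.mem_singleton]
  constructor
  · rintro ⟨-, h1, h2⟩
    by_contra h3
    exact hc i h3 h1 h2
  · rintro rfl
    exact ⟨by omega, hp, hpu⟩

theorem stmt4 (w : List A) (hw : w ≠ []) :
    R w + K w + (Alph w).card ≤ w.length + 2 ∧
    L w + H w + (Alph w).card ≤ w.length + 2 := by
  constructor
  · apply core w _ _ hw
    · intro n hn hlt
      have h := Nat.notMem_of_lt_sInf hlt
      simp only [Set.mem_setOf_eq, not_and, not_forall, not_not] at h
      obtain ⟨u, hl, -, hv⟩ := h hn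
      obtain ⟨x, hx, y, hy, hxy⟩ := Finset.one_lt_card.mp (show 1 < _ from hv)
      exact ⟨u, x, y, hxy, hl, (Finset.mem_filter.mp hx).2, (Finset.mem_filter.mp hy).2⟩
    · intro n hlt s hs hl
      have h := Nat.notMem_of_lt_sInf hlt
      simp only [Set.mem_setOf_eq, not_exists, not_and] at h
      have h := h s hs hl
      have hle := hs.length_le
      have hd := List.suffix_iff_eq_drop.mp hs
      obtain ⟨i, h1, h2, h3⟩ := exists_other w s (w.length - s.length) (by omega)
        (by rw [← hd]; simp) h
      have hlt : i + s.length < w.length := by omega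
      refine ⟨w[i + s.length], ?_⟩
      have : s ++ [w[i + s.length]] = (w.drop i).take (s.length + 1) := by
        rw [List.take_add_one, h3]
        simp [hlt]
      rw [this]
      exact (List.take_prefix _ _).isInfix.trans (List.drop_suffix _ _).isInfix
  · have hA : Alph w.reverse = Alph w := by ext; simp [Alph]
    have hc := core w.reverse (L w) (H w) (by simpa using hw) ?_ ?_
    · simpa [hA] using hc
    · intro n hn hlt
      have h := Nat.notMem_of_lt_sInf hlt
      simp only [Set.mem_setOf_eq, not_and, not_forall, not_not] at h
      obtain ⟨u, hl, -, hv⟩ := h hn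
      obtain ⟨x, hx, y, hy, hxy⟩ := Finset.one_lt_card.mp (show 1 < _ from hv)
      refine ⟨u.reverse, x, y, hxy, by simpa using hl, ?_, ?_⟩
      · rw [← List.reverse_cons, List.reverse_infix]; exact (Finset.mem_filter.mp hx).2
      · rw [← List.reverse_cons, List.reverse_infix]; exact (Finset.mem_filter.mp hy).2
    · intro n hlt s hs hl
      have h := Nat.notMem_of_lt_sInf hlt
      simp only [Set.mem_setOf_eq, not_exists, not_and] at h
      obtain ⟨t, rfl⟩ : ∃ t : List A, s = t.reverse := ⟨s.reverse, by simp⟩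
      rw [List.reverse_suffix] at hs
      have hl : t.length = n := by simpa using hl
      have h := h t hs hl
      have hle := hs.length_le
      have hd := List.prefix_iff_eq_take.mp hs
      obtain ⟨i, h1, h2, h3⟩ := exists_other w t 0 (by omega)
        (by rw [List.drop_zero, ← hd]) h
      obtain ⟨j, rfl⟩ : ∃ j, i = j + 1 := ⟨i - 1, by omega⟩
      have hlt : j < w.length := by omega
      refine ⟨w[j], ?_⟩
      rw [← List.reverse_cons, List.reverse_infix]
      have : w[j] :: t = (w.drop j).take (t.length + 1) := by
        rw [List.drop_eq_getElem_cons hlt, List.take_succ_cons, h3]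
      rw [this]
      exact (List.take_prefix _ _).isInfix.trans (List.drop_suffix _ _).isInfix
end

section
/- Let w be a nonempty finite word with minimal period length π_w. Then π_w + 1 ≥ R_w + |Alph(w)|. Moreover, if π_w + 1 = R_w + |Alph(w)|, then |w| + 2 = R_w + K_w + |Alph(w)|. -/
open List

variable {A : Type*} [DecidableEq A]

/-- The window of length `n` starting at `i` in the infinite word `W`. -/
def win {B : Type*} (W : ℕ → B) (n i : ℕ) : List B := (List.range n).map (fun k => W (i + k))

theorem win_length {B : Type*} (W : ℕ → B) (n i : ℕ) : (win W n i).length = n := by simp [win]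

theorem win_succ {B : Type*} (W : ℕ → B) (n i : ℕ) :
    win W (n + 1) i = win W n i ++ [W (i + n)] := by simp [win, List.range_succ]

theorem win_eq_iff {B : Type*} (W : ℕ → B) (n i j : ℕ) :
    win W n i = win W n j ↔ ∀ k < n, W (i + k) = W (j + k) := by
  simp [win]

theorem win_dropLast {B : Type*} (W : ℕ → B) (n i : ℕ) :
    (win W (n + 1) i).dropLast = win W n i := by simp [win_succ]

theorem win_slice {B : Type*} (W : ℕ → B) (w : List B) (hW : ∀ i (h : i < w.length), W i = w[i])
    (n i : ℕ) (h : i + n ≤ w.length) : (w.drop i).take n = win W n i := by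
  apply List.ext_getElem
  · simp [win]; omega
  · intro k h1 h2
    simp [win] at h1 h2 ⊢
    rw [hW _ (by omega)]

theorem infix_win {B : Type*} (W : ℕ → B) (w : List B) (hW : ∀ i (h : i < w.length), W i = w[i])
    (u : List B) (h : u <:+: w) : ∃ i, i + u.length ≤ w.length ∧ win W u.length i = u := by
  obtain ⟨s, t, rfl⟩ := h
  refine ⟨s.length, by simp, ?_⟩
  rw [← win_slice W _ hW _ _ (by simp)]
  simp

/-- The windows of length `n` starting in the first period. -/
def wins {B : Type*} [DecidableEq B] (W : ℕ → B) (p n : ℕ) : Finset (List B) :=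
  (Finset.range p).image (win W n)

theorem mem_wins {B : Type*} [DecidableEq B] (W : ℕ → B) (p n : ℕ) (hp : 0 < p)
    (hper : ∀ i, W (i % p) = W i) (i : ℕ) : win W n i ∈ wins W p n := by
  unfold wins
  rw [Finset.mem_image]
  refine ⟨i % p, by simpa using Nat.mod_lt _ hp, ?_⟩
  rw [win_eq_iff]
  intro k _
  rw [← hper, ← hper (i + k)]
  simp

theorem wins_image {B : Type*} [DecidableEq B] (W : ℕ → B) (p n : ℕ) :
    wins W p n = (wins W p (n + 1)).image List.dropLast := by
  unfold wins
  rw [Finset.image_image]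
  congr 1
  funext i
  simp [win_dropLast]

theorem wins_lt {B : Type*} [DecidableEq B] (W : ℕ → B) (p n : ℕ) (x y : List B)
    (hx : x ∈ wins W p (n + 1)) (hy : y ∈ wins W p (n + 1)) (hxy : x ≠ y)
    (h : x.dropLast = y.dropLast) : (wins W p n).card + 1 ≤ (wins W p (n + 1)).card := by
  have : wins W p n ⊆ ((wins W p (n + 1)).erase x).image List.dropLast := by
    intro t ht
    rw [wins_image, Finset.mem_image] at ht
    obtain ⟨z, hz, rfl⟩ := ht
    rw [Finset.mem_image]
    by_cases hzx : z = x
    · exact ⟨y, by simp [hy, hxy.symm], by rw [hzx, h]⟩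
    · exact ⟨z, by simp [hz, hzx], rfl⟩
  have h1 := (Finset.card_le_card this).trans Finset.card_image_le
  have h2 := Finset.card_erase_add_one hx
  omega

theorem wins_lt2 {B : Type*} [DecidableEq B] (W : ℕ → B) (p n : ℕ) (x y x' y' : List B)
    (hx : x ∈ wins W p (n + 1)) (hy : y ∈ wins W p (n + 1))
    (hx' : x' ∈ wins W p (n + 1)) (hy' : y' ∈ wins W p (n + 1))
    (hxy : y ≠ x) (hxx' : x' ≠ x) (hyx' : y ≠ x') (hy'x : y' ≠ x) (hy'x' : y' ≠ x')
    (h : x.dropLast = y.dropLast) (h' : x'.dropLast = y'.dropLast) :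
    (wins W p n).card + 2 ≤ (wins W p (n + 1)).card := by
  have : wins W p n ⊆ (((wins W p (n + 1)).erase x).erase x').image List.dropLast := by
    intro t ht
    rw [wins_image, Finset.mem_image] at ht
    obtain ⟨z, hz, rfl⟩ := ht
    rw [Finset.mem_image]
    by_cases hzx : z = x
    · exact ⟨y, by simp [hy, hxy, hyx'], by rw [hzx, h]⟩
    by_cases hzx' : z = x'
    · exact ⟨y', by simp [hy', hy'x, hy'x'], by rw [hzx', h']⟩
    · exact ⟨z, by simp [hz, hzx, hzx'], rfl⟩
  have h1 := (Finset.card_le_card this).trans Finset.card_image_le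
  have h2 := Finset.card_erase_add_one hx
  have h3 := Finset.card_erase_add_one (s := (wins W p (n + 1)).erase x) (a := x')
    (by simp [hx', hxx'])
  omega

theorem R_spec_s7 (w : List A) : 0 < R w ∧
    ∀ n, 0 < n → n < R w → ∃ u : List A, u.length = n ∧ RightSpecial w u := by
  have hne : {r : ℕ | 0 < r ∧ ∀ u : List A, u.length = r → ¬ RightSpecial w u}.Nonempty := by
    refine ⟨w.length + 1, by simp, ?_⟩
    intro u hu h
    have := h.1.length_le
    omega
  refine ⟨(Nat.sInf_mem hne).1, ?_⟩
  intro n hn hlt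
  have := Nat.notMem_of_lt_sInf hlt
  simp only [Set.mem_ofPred_eq, not_and, not_forall, not_not] at this
  obtain ⟨u, h1, h2⟩ := this hn
  exact ⟨u, h1, h2⟩

theorem rs_win (W : ℕ → A) (w : List A) (hW : ∀ i (h : i < w.length), W i = w[i])
    (u : List A) (n : ℕ) (hu : u.length = n) (h : RightSpecial w u) :
    ∃ i j, i + n + 1 ≤ w.length ∧ j + n + 1 ≤ w.length ∧ win W (n + 1) i ≠ win W (n + 1) j ∧
      win W n i = win W n j := by
  obtain ⟨a, ha, b, hb, hab⟩ := Finset.one_lt_card.1 (show 1 < rightValence w u from h.2)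
  simp only [Finset.mem_filter] at ha hb
  obtain ⟨i, hi, hi'⟩ := infix_win W w hW _ ha.2
  obtain ⟨j, hj, hj'⟩ := infix_win W w hW _ hb.2
  simp only [List.length_append, List.length_singleton, hu] at hi hj hi' hj'
  refine ⟨i, j, by omega, by omega, ?_, ?_⟩
  · rw [hi', hj']
    simpa using hab
  · rw [← win_dropLast W n i, ← win_dropLast W n j, hi', hj']
    simp

theorem growth {B : Type*} [DecidableEq B] (W : ℕ → B) (p r : ℕ)
    (hg : ∀ n, 0 < n → n < r → (wins W p n).card + 1 ≤ (wins W p (n + 1)).card)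
    (m : ℕ) (hm : 0 < m) : ∀ n, m + n ≤ r → (wins W p m).card + n ≤ (wins W p (m + n)).card := by
  intro n
  induction n with
  | zero => simp
  | succ k ih =>
    intro h
    have h1 := ih (by omega)
    have h2 := hg (m + k) (by omega) (by omega)
    rw [show m + (k + 1) = m + k + 1 by omega]
    omega

theorem minPeriod_spec (w : List A) (hw : w ≠ []) :
    IsPeriod w (minPeriod w) ∧ minPeriod w ≤ w.length := by
  have h : w.length ∈ {p : ℕ | IsPeriod w p} :=
    ⟨List.length_pos_of_ne_nil hw, fun i hi => by omega⟩
  exact ⟨Nat.sInf_mem ⟨_, h⟩, Nat.sInf_le h⟩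

theorem ext_spec (w : List A) (hw : w ≠ []) (p : ℕ) (hp : IsPeriod w p) :
    ∃ W : ℕ → A, (∀ i, W (i % p) = W i) ∧ ∀ i (h : i < w.length), W i = w[i] := by
  refine ⟨fun i => w.getD (i % p) (w.head hw), by simp, ?_⟩
  intro i
  induction i using Nat.strong_induction_on with
  | _ i ih =>
    intro h
    by_cases hip : i < p
    · simp [Nat.mod_eq_of_lt hip, h]
    · have h0 := hp.1
      have h1 := ih (i - p) (by omega) (by omega)
      have h2 := hp.2 (i - p) (by omega)
      rw [Nat.sub_add_cancel (by omega), List.getElem?_eq_getElem (by omega),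
        List.getElem?_eq_getElem h, Option.some_inj] at h2
      rw [← h2, ← h1]
      simp only [Nat.mod_eq_sub_mod (not_lt.1 hip)]

theorem K_eq (w : List A) (p : ℕ) (hp : 0 < p) (hpl : p ≤ w.length) (W : ℕ → A)
    (hper : ∀ i, W (i % p) = W i) (hW : ∀ i (h : i < w.length), W i = w[i])
    (huniq : ∀ i, i < p - 1 →
      win W (w.length - p + 1) i ≠ win W (w.length - p + 1) (p - 1)) :
    K w = w.length - p + 1 := by
  apply le_antisymm
  · apply Nat.sInf_le
    refine ⟨w.drop (p - 1), List.drop_suffix _ _, by simp; omega, ?_⟩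
    have hl : (w.drop (p - 1)).length = w.length - p + 1 := by simp; omega
    have hs : w.drop (p - 1) = win W (w.length - p + 1) (p - 1) := by
      rw [← win_slice W w hW _ _ (by omega), List.take_of_length_le (by omega)]
    unfold occCount
    rw [Finset.card_eq_one]
    refine ⟨p - 1, ?_⟩
    ext i
    rw [hl]
    simp only [Finset.mem_filter, Finset.mem_range, Finset.mem_singleton]
    constructor
    · rintro ⟨_, h2, h3⟩
      by_contra hne
      rw [win_slice W w hW _ _ h2, hs] at h3
      exact huniq i (by omega) h3
    · rintro rfl
      refine ⟨by omega, by omega, ?_⟩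
      rw [List.take_of_length_le (by omega)]
  · have hne : {k : ℕ | ∃ u : List A, u <:+ w ∧ u.length = k ∧ occCount w u = 1}.Nonempty := by
      refine ⟨w.length, w, List.suffix_refl _, rfl, ?_⟩
      unfold occCount
      rw [Finset.card_eq_one]
      refine ⟨0, ?_⟩
      ext i
      simp only [Finset.mem_filter, Finset.mem_range, Finset.mem_singleton]
      constructor
      · rintro ⟨_, h, _⟩; omega
      · rintro rfl; simp
    obtain ⟨u, hu, hk, ho⟩ := Nat.sInf_mem hne
    change u.length = K w at hk
    rw [← hk]
    by_contra hlt
    have hul : u = win W u.length (w.length - u.length) := by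
      rw [← win_slice W w hW _ _ (by omega), List.take_of_length_le (by simp; omega)]
      exact List.suffix_iff_eq_drop.1 hu
    have hul' : u = win W u.length (w.length - u.length - p) := by
      conv_lhs => rw [hul]
      rw [win_eq_iff]
      intro k _
      have hk2 : w.length - u.length + k = w.length - u.length - p + k + p := by omega
      rw [← hper, ← hper (w.length - u.length - p + k), hk2, Nat.add_mod_right]
    have h2 : 1 < occCount w u := by
      apply Finset.one_lt_card.2
      refine ⟨w.length - u.length, ?_, w.length - u.length - p, ?_, by omega⟩
      · simp only [Finset.mem_filter, Finset.mem_range]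
        refine ⟨by omega, by omega, ?_⟩
        rw [win_slice W w hW _ _ (by omega), ← hul]
      · simp only [Finset.mem_filter, Finset.mem_range]
        refine ⟨by omega, by omega, ?_⟩
        rw [win_slice W w hW _ _ (by omega), ← hul']
    omega

theorem stmt7 (w : List A) (hw : w ≠ []) :
    R w + (Alph w).card ≤ minPeriod w + 1 ∧
    (minPeriod w + 1 = R w + (Alph w).card →
      w.length + 2 = R w + K w + (Alph w).card) := by
  obtain ⟨hP, hpl⟩ := minPeriod_spec w hw
  obtain ⟨W, hper, hW⟩ := ext_spec w hw _ hP
  obtain ⟨hR0, hR⟩ := R_spec_s7 w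
  generalize minPeriod w = p at *
  have hp : 0 < p := hP.1
  have hmem := fun n i => mem_wins W p n hp hper i
  have hg : ∀ n, 0 < n → n < R w → (wins W p n).card + 1 ≤ (wins W p (n + 1)).card := by
    intro n h0 h1
    obtain ⟨u, hu, hrs⟩ := hR n h0 h1
    obtain ⟨i, j, -, -, hne, he⟩ := rs_win W w hW u n hu hrs
    exact wins_lt W p n _ _ (hmem _ i) (hmem _ j) hne (by simpa [win_dropLast] using he)
  have hA : (Alph w).card ≤ (wins W p 1).card := by
    rw [← Finset.card_image_of_injective (Alph w) (f := fun x => [x])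
      (fun a b h => by simpa using h)]
    apply Finset.card_le_card
    intro t ht
    rw [Finset.mem_image] at ht
    obtain ⟨x, hx, rfl⟩ := ht
    obtain ⟨i, hi, rfl⟩ := List.mem_iff_getElem.1 (List.mem_toFinset.1 hx)
    have := hmem 1 i
    simpa [win, hW i hi] using this
  have hcard : ∀ n, (wins W p n).card ≤ p := fun n => by
    simpa [wins] using (Finset.card_image_le (s := Finset.range p) (f := win W n))
  have hgr := growth W p (R w) hg
  have h1R := hgr 1 one_pos (R w - 1) (by omega)
  rw [show 1 + (R w - 1) = R w by omega] at h1R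
  have hcR := hcard (R w)
  refine ⟨by omega, ?_⟩
  intro heq
  have hinj : Set.InjOn (win W (R w)) (Finset.range p : Set ℕ) := by
    apply Finset.card_image_iff.1
    change (wins W p (R w)).card = _
    simp only [Finset.card_range]
    omega
  have hno : ∀ n i, R w ≤ n → i < p - 1 → win W n i ≠ win W n (p - 1) := by
    intro n i hn hi he
    have : i = p - 1 := by
      apply hinj (by simp; omega) (by simp; omega)
      rw [win_eq_iff] at he ⊢
      exact fun k hk => he k (by omega)
    omega
  have hK : K w = w.length - p + 1 := by
    apply K_eq w p hp hpl W hper hW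
    intro i0 hi0 he0
    -- the greatest length with a repeated window
    let P : ℕ → Prop := fun n => ∃ i, i < p - 1 ∧ win W n i = win W n (p - 1)
    classical
    have hPb : ∀ n, P n → n < R w := by
      rintro n ⟨i, hi, he⟩
      by_contra h
      exact hno n i (by omega) hi he
    have hP0 : P (w.length - p + 1) := ⟨i0, hi0, he0⟩
    obtain ⟨n, hn1, hn2, hn3⟩ : ∃ n, w.length - p + 1 ≤ n ∧ P n ∧ ¬ P (n + 1) := by
      by_contra hcon
      push Not at hcon
      have : ∀ k, P (w.length - p + 1 + k) := by
        intro k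
        induction k with
        | zero => exact hP0
        | succ k ih => exact hcon _ (Nat.le_add_right _ _) ih
      have := hPb _ (this (R w))
      omega
    have hnR := hPb n hn2
    obtain ⟨i, hi, hei⟩ := hn2
    have hx : ∀ j, j < p - 1 → win W (n + 1) j ≠ win W (n + 1) (p - 1) :=
      fun j hj he => hn3 ⟨j, hj, he⟩
    obtain ⟨u, hu, hrs⟩ := hR n (by omega) hnR
    obtain ⟨j1, j2, hj1, hj2, hne, he⟩ := rs_win W w hW u n hu hrs
    have key : (wins W p n).card + 2 ≤ (wins W p (n + 1)).card := by
      by_cases ht : win W n j1 = win W n (p - 1)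
      · apply wins_lt2 W p n (win W (n + 1) (p - 1)) (win W (n + 1) j2) (win W (n + 1) j1)
          (win W (n + 1) j2) (hmem _ _) (hmem _ _) (hmem _ _) (hmem _ _)
          (hx _ (by omega)) (hx _ (by omega)) hne.symm (hx _ (by omega)) hne.symm
        · simp only [win_dropLast]; rw [← he, ht]
        · simp only [win_dropLast]; exact he
      · apply wins_lt2 W p n (win W (n + 1) (p - 1)) (win W (n + 1) i) (win W (n + 1) j1)
          (win W (n + 1) j2) (hmem _ _) (hmem _ _) (hmem _ _) (hmem _ _)
          (hx _ (by omega)) (hx _ (by omega)) ?_ (hx _ (by omega)) hne.symm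
        · simp only [win_dropLast]; exact hei.symm
        · simp only [win_dropLast]; exact he
        · intro h
          apply ht
          rw [← hei, ← win_dropLast, ← h, win_dropLast]
    have g1 := hgr 1 one_pos (n - 1) (by omega)
    rw [show 1 + (n - 1) = n by omega] at g1
    have g2 := hgr (n + 1) (by omega) (R w - (n + 1)) (by omega)
    rw [show n + 1 + (R w - (n + 1)) = R w by omega] at g2
    omega
  omega
end
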